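/- arXiv:2407.15210 — 2 statements merged into one kernel-verified Lean document; each statement's English description precedes it below -/
import Mathlib

section
/- If 0 < a ≤ 1/e, then the set of representable elements of the extended real line EReal has empty interior in EReal; in particular, not every element of EReal is representable. -/
open Filter Topology

/-- Exponential on the extended real line, with e^{-∞}=0 and e^{+∞}=+∞. -/
noncomputable def eexp (y : EReal) : EReal :=
  if y = ⊥ then (0 : EReal) else if y = ⊤ then ⊤ else ((Real.exp y.toReal : ℝ) : EReal)

/-- `fSgn a s` is `f₊ : x ↦ e^{a·x}` when `s = true` and `f₋ : x ↦ -e^{a·x}` when `s = false`. -/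
noncomputable def fSgn (a : ℝ) (s : Bool) (x : EReal) : EReal :=
  if s then eexp ((a : EReal) * x) else -eexp ((a : EReal) * x)

/-- `uSeq a n ε = f_{ε₁}(f_{ε₂}(⋯ f_{ε_n}(1)⋯))`, where `ε (k-1)` is the k-th sign. -/
noncomputable def uSeq (a : ℝ) : ℕ → (ℕ → Bool) → EReal
  | 0, _ => 1
  | n + 1, ε => fSgn a (ε 0) (uSeq a n (fun k => ε (k + 1)))

/-- `ε` represents `t` if `(u_{n,ε})_n` tends to `t` in `EReal`. -/
def Represents (a : ℝ) (ε : ℕ → Bool) (t : EReal) : Prop :=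
  Filter.Tendsto (fun n => uSeq a n ε) Filter.atTop (nhds t)

/-- `t` is representable if some sign sequence represents it. -/
def Representable (a : ℝ) (t : EReal) : Prop :=
  ∃ ε : ℕ → Bool, Represents a ε t

/-- For a finite word `γ = γ₁⋯γ_k`, `fWord a γ = f_{γ₁} ∘ ⋯ ∘ f_{γ_k}`. -/
noncomputable def fWord (a : ℝ) (γ : List Bool) (x : EReal) : EReal :=
  γ.foldr (fSgn a) x

/-- `I(ε) = ⋂ₙ I(n,ε)` where `I(n,ε)` is the image of `EReal` under `f_{ε₁} ∘ ⋯ ∘ f_{ε_n}`. -/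
noncomputable def Iset (a : ℝ) (ε : ℕ → Bool) : Set EReal :=
  ⋂ n : ℕ, Set.range (fWord a (List.ofFn fun i : Fin n => ε i))

/-- `X` is the union over all finite words `γ` of the images `f_γ(]m,+∞])`. -/
noncomputable def Xset (a m : ℝ) : Set EReal :=
  ⋃ γ : List Bool, fWord a γ '' Set.Ioi (m : EReal)

/-- Real-valued version of `uSeq`. -/
noncomputable def vSeq (a : ℝ) : ℕ → (ℕ → Bool) → ℝ
  | 0, _ => 1
  | n + 1, ε => (if ε 0 then 1 else -1) * Real.exp (a * vSeq a n (fun k => ε (k + 1)))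

lemma fSgn_coe (a : ℝ) (s : Bool) (x : ℝ) :
    fSgn a s (x : EReal) = (((if s then 1 else -1) * Real.exp (a * x) : ℝ) : EReal) := by
  have h : eexp ((a : EReal) * (x : EReal)) = ((Real.exp (a * x) : ℝ) : EReal) := by
    rw [← EReal.coe_mul]
    simp [eexp, -EReal.coe_mul]
  unfold fSgn
  rw [h]
  cases s <;> simp

lemma uSeq_eq (a : ℝ) (n : ℕ) (ε : ℕ → Bool) : uSeq a n ε = ((vSeq a n ε : ℝ) : EReal) := by
  induction n generalizing ε with
  | zero => simp [uSeq, vSeq]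
  | succ n ih => rw [uSeq, ih, fSgn_coe, vSeq]

lemma abs_vSeq_succ (a : ℝ) (n : ℕ) (ε : ℕ → Bool) :
    |vSeq a (n+1) ε| = Real.exp (a * vSeq a n (fun k => ε (k + 1))) := by
  rw [vSeq, abs_mul, abs_of_pos (Real.exp_pos _)]
  cases ε 0 <;> simp

lemma vSeq_bound {a : ℝ} (ha : 0 < a) (hae : a * Real.exp 1 ≤ 1) (n : ℕ) (ε : ℕ → Bool) :
    |vSeq a n ε| ≤ Real.exp 1 := by
  induction n generalizing ε with
  | zero => simp [vSeq]
  | succ n ih =>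
    rw [abs_vSeq_succ]
    apply Real.exp_le_exp.2
    refine le_trans ?_ hae
    exact mul_le_mul_of_nonneg_left ((le_abs_self _).trans (ih _)) ha.le

/-- Real representable numbers. -/
def RepR (a t : ℝ) : Prop := ∃ ε : ℕ → Bool, Tendsto (fun n => vSeq a n ε) atTop (𝓝 t)

lemma rep_coe (a t : ℝ) : Representable a (t : EReal) ↔ RepR a t := by
  unfold Representable RepR Represents
  simp only [uSeq_eq, EReal.tendsto_coe]

lemma rep_real {a : ℝ} (ha : 0 < a) (hae : a * Real.exp 1 ≤ 1) {t : EReal}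
    (h : Representable a t) : ∃ x : ℝ, t = x := by
  obtain ⟨ε, h⟩ := h
  unfold Represents at h
  simp only [uSeq_eq] at h
  have h1 : t ≤ ((Real.exp 1 : ℝ) : EReal) := le_of_tendsto' h fun n =>
    EReal.coe_le_coe_iff.2 (abs_le.1 (vSeq_bound ha hae n ε)).2
  have h2 : ((-Real.exp 1 : ℝ) : EReal) ≤ t := ge_of_tendsto' h fun n =>
    EReal.coe_le_coe_iff.2 (abs_le.1 (vSeq_bound ha hae n ε)).1
  induction t with
  | bot => exact absurd h2 (by simp [-EReal.coe_neg])
  | top => exact absurd h1 (by simp)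
  | coe x => exact ⟨x, rfl⟩

lemma repR_bound {a : ℝ} (ha : 0 < a) (hae : a * Real.exp 1 ≤ 1) {t : ℝ}
    (h : RepR a t) : |t| ≤ Real.exp 1 := by
  obtain ⟨ε, h⟩ := h
  exact le_of_tendsto' h.abs fun n => vSeq_bound ha hae n ε

lemma repR_ne_zero {a : ℝ} (ha : 0 < a) (hae : a * Real.exp 1 ≤ 1) {t : ℝ}
    (h : RepR a t) : t ≠ 0 := by
  obtain ⟨ε, h⟩ := h
  have h1 := (h.comp (tendsto_add_atTop_nat 1)).abs
  have : Real.exp (-1) ≤ |t| := by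
    refine ge_of_tendsto' h1 fun n => ?_
    simp only [Function.comp]
    rw [abs_vSeq_succ]
    apply Real.exp_le_exp.2
    have := (abs_le.1 (vSeq_bound ha hae n (fun k => ε (k + 1)))).1
    nlinarith
  have h3 := Real.exp_pos (-1)
  exact abs_pos.1 (h3.trans_le this)

lemma repR_log {a : ℝ} (ha : 0 < a) (hae : a * Real.exp 1 ≤ 1) {t : ℝ}
    (h : RepR a t) : RepR a (Real.log t / a) := by
  have h0 := repR_ne_zero ha hae h
  obtain ⟨ε, h⟩ := h
  refine ⟨fun k => ε (k+1), ?_⟩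
  have h1 := (((h.comp (tendsto_add_atTop_nat 1)).log h0).div_const a)
  refine h1.congr fun n => ?_
  simp only [Function.comp]
  rw [← Real.log_abs, abs_vSeq_succ, Real.log_exp]
  field_simp

lemma log_gain {a : ℝ} (ha : 0 < a) (hae : a * Real.exp 1 ≤ 1) {c d : ℝ} (hc : 0 < c)
    (hcd : c < d) (hd : d ≤ Real.exp 1) :
    (d - c) + (d - c)^2 / (4 * Real.exp 1) ≤ Real.log d / a - Real.log c / a := by
  have he := Real.exp_pos 1
  set E := Real.exp 1
  have key : ∀ x y : ℝ, 0 < x → x < y → (y - x) / y ≤ Real.log y - Real.log x := by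
    intro x y hx hxy
    have hy := hx.trans hxy
    have := Real.one_sub_inv_le_log_of_pos (div_pos hy hx)
    rw [Real.log_div hy.ne' hx.ne'] at this
    convert this using 1
    field_simp
  set p := (c + d) / 2 with hp
  have k1 := key c p hc (by linarith)
  have k2 := key p d (by linarith) (by linarith)
  have hp0 : 0 < p := by linarith
  have g2 : (d - p) / E ≤ (d - p) / d :=
    div_le_div_of_nonneg_left (by linarith) (by linarith) hd
  have g1 : (p - c) / E + (p - c) * (d - p) / E^2 ≤ (p - c) / p := by
    rw [div_add_div _ _ he.ne' (by positivity), div_le_div_iff₀ (by positivity) hp0]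
    have hpc : 0 < p - c := by linarith
    have hdp : 0 < d - p := by linarith
    have : (E + (d - p)) * p ≤ E^2 := by nlinarith
    nlinarith [mul_le_mul_of_nonneg_left this (mul_pos hpc he).le]
  have hsum : (d - c) / E + (d-c)^2 / (4 * E^2) ≤ Real.log d - Real.log c := by
    have e1 : (d - c) / E + (d-c)^2 / (4 * E^2)
      = (d - p) / E + ((p - c) / E + (p - c) * (d - p) / E^2) := by
      rw [hp]; field_simp; ring
    linarith
  rw [← sub_div, le_div_iff₀ ha]
  refine le_trans ?_ hsum
  have e2 : (d - c) / E + (d-c)^2 / (4 * E^2) = ((d - c) + (d - c)^2 / (4 * E)) * (1 / E) := by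
    field_simp
  rw [e2]
  apply mul_le_mul_of_nonneg_left
  · rw [le_div_iff₀ he]; exact hae
  · have : 0 < d - c := by linarith
    positivity

lemma step {a : ℝ} (ha : 0 < a) (hae : a * Real.exp 1 ≤ 1) {c d : ℝ} (hcd : c < d)
    (h : ∀ t ∈ Set.Icc c d, RepR a t) :
    ∃ c' d', c' < d' ∧ (d - c) + (d - c)^2 / (4 * Real.exp 1) ≤ d' - c' ∧
      ∀ t ∈ Set.Icc c' d', RepR a t := by
  have hpos : 0 < (d - c) + (d - c)^2 / (4 * Real.exp 1) := by
    have : 0 < d - c := by linarith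
    positivity
  have bc := abs_le.1 (repR_bound ha hae (h c ⟨le_rfl, hcd.le⟩))
  have bd := abs_le.1 (repR_bound ha hae (h d ⟨hcd.le, le_rfl⟩))
  have main : 0 < c ∨ d < 0 := by
    by_contra! hh
    exact repR_ne_zero ha hae (h 0 ⟨hh.1, hh.2⟩) rfl
  have tr : ∀ x y t : ℝ, 0 < x → 0 < y → t ∈ Set.Icc (Real.log x / a) (Real.log y / a) →
      x ≤ Real.exp (a * t) ∧ Real.exp (a * t) ≤ y := by
    intro x y t hx hy ht
    rw [Set.mem_Icc, div_le_iff₀ ha, le_div_iff₀ ha, mul_comm t a] at ht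
    exact ⟨(Real.log_le_iff_le_exp hx).1 ht.1, (Real.le_log_iff_exp_le hy).1 ht.2⟩
  rcases main with hc | hd
  · have g := log_gain ha hae hc hcd bd.2
    refine ⟨_, _, by linarith, g, fun t ht => ?_⟩
    have := repR_log ha hae (h _ (tr _ _ _ hc (hc.trans hcd) ht))
    rwa [Real.log_exp, mul_div_cancel_left₀ _ ha.ne'] at this
  · have g := log_gain ha hae (c := -d) (d := -c) (by linarith) (by linarith) (by linarith)
    have e : -c - -d = d - c := by ring
    rw [e] at g
    refine ⟨_, _, by linarith, g, fun t ht => ?_⟩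
    have h2 := tr _ _ _ (by linarith) (by linarith) ht
    have := repR_log ha hae (h (-Real.exp (a * t)) ⟨by linarith, by linarith⟩)
    rwa [Real.log_neg_eq_log, Real.log_exp, mul_div_cancel_left₀ _ ha.ne'] at this

lemma no_interval {a : ℝ} (ha : 0 < a) (hae : a * Real.exp 1 ≤ 1) {c d : ℝ} (hcd : c < d) :
    ¬ ∀ t ∈ Set.Icc c d, RepR a t := by
  intro h
  have he := Real.exp_pos 1
  have hl : 0 < d - c := by linarith
  have hη : 0 < (d - c)^2 / (4 * Real.exp 1) := by positivity
  have it : ∀ n : ℕ, ∃ c' d', c' < d' ∧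
      (d - c) + n * ((d - c)^2 / (4 * Real.exp 1)) ≤ d' - c' ∧
      ∀ t ∈ Set.Icc c' d', RepR a t := by
    intro n
    induction n with
    | zero => exact ⟨c, d, hcd, by simp, h⟩
    | succ n ih =>
      obtain ⟨c', d', h1, h2, h3⟩ := ih
      obtain ⟨c'', d'', k1, k2, k3⟩ := step ha hae h1 h3
      refine ⟨c'', d'', k1, ?_, k3⟩
      have hle : d - c ≤ d' - c' := by
        have : 0 ≤ (n : ℝ) * ((d - c)^2 / (4 * Real.exp 1)) := by positivity
        linarith
      have : (d - c)^2 / (4 * Real.exp 1) ≤ (d' - c')^2 / (4 * Real.exp 1) := by gcongr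
      push_cast
      linarith
  obtain ⟨n, hn⟩ := exists_nat_gt (2 * Real.exp 1 / ((d - c)^2 / (4 * Real.exp 1)))
  rw [div_lt_iff₀ hη] at hn
  obtain ⟨c', d', h1, h2, h3⟩ := it n
  have bc := abs_le.1 (repR_bound ha hae (h3 c' ⟨le_rfl, h1.le⟩))
  have bd := abs_le.1 (repR_bound ha hae (h3 d' ⟨h1.le, le_rfl⟩))
  linarith

/-- If `0 < a ≤ 1/e`, the set of representable elements has empty interior
in `EReal`; in particular not every element of `EReal` is representable. -/
theorem interior_representable_empty (a : ℝ) (ha : 0 < a) (ha' : a ≤ 1 / Real.exp 1) :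
    interior {t : EReal | Representable a t} = ∅ ∧ ∃ t : EReal, ¬ Representable a t := by
  have hae : a * Real.exp 1 ≤ 1 := (le_div_iff₀ (Real.exp_pos 1)).1 ha'
  constructor
  · rw [Set.eq_empty_iff_forall_notMem]
    intro t ht
    obtain ⟨x, rfl⟩ := rep_real (t := t) ha hae
      (interior_subset (s := {t : EReal | Representable a t}) ht)
    have ho : IsOpen ((fun y : ℝ => (y : EReal)) ⁻¹' interior {t : EReal | Representable a t}) :=
      isOpen_interior.preimage continuous_coe_real_ereal
    obtain ⟨δ, hδ, hb⟩ := Metric.isOpen_iff.1 ho x ht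
    refine no_interval ha hae (c := x) (d := x + δ / 2) (by linarith) fun y hy => ?_
    rw [← rep_coe]
    have hy2 : y ∈ Metric.ball x δ := by
      rw [Metric.mem_ball, Real.dist_eq, abs_lt]
      constructor <;> linarith [hy.1, hy.2]
    exact interior_subset (s := {t : EReal | Representable a t}) (hb hy2)
  · refine ⟨⊤, fun h => ?_⟩
    obtain ⟨x, hx⟩ := rep_real ha hae h
    exact EReal.coe_ne_top x hx.symm
end

section
/- Let a > 0 and let ε and ε' be two distinct sign sequences. Then the intersection I(ε) ∩ I(ε') contains at most one element (it is a subsingleton). -/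
open Filter Topology

theorem eexp_bot' : eexp ⊥ = 0 := by simp [eexp]

theorem eexp_top' : eexp ⊤ = ⊤ := by simp [eexp]

theorem eexp_coe' (r : ℝ) : eexp (r : EReal) = ((Real.exp r : ℝ) : EReal) := by simp [eexp]

theorem eexp_nonneg' (y : EReal) : 0 ≤ eexp y := by
  induction y using EReal.rec with
  | bot => simp [eexp_bot']
  | top => simp [eexp_top']
  | coe r => rw [eexp_coe']; exact_mod_cast (Real.exp_pos r).le

theorem eexp_mul_inj (a : ℝ) (ha : 0 < a) :
    Function.Injective (fun x : EReal => eexp ((a : EReal) * x)) := by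
  intro x y h
  have e0 : ∀ r : ℝ, ((Real.exp r : ℝ) : EReal) ≠ 0 := fun r => by
    exact_mod_cast (Real.exp_pos r).ne'
  induction x using EReal.rec <;> induction y using EReal.rec <;>
    simp only [EReal.coe_mul_bot_of_pos ha, EReal.coe_mul_top_of_pos ha, ← EReal.coe_mul,
      eexp_bot', eexp_top', eexp_coe'] at h ⊢
  · exact absurd h.symm (e0 _)
  · exact absurd h EReal.zero_ne_top
  · exact absurd h (e0 _)
  · have h2 := Real.exp_injective (EReal.coe_injective h)
    rw [mul_left_cancel₀ ha.ne' h2]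
  · exact absurd h (EReal.coe_ne_top _)
  · exact absurd h.symm EReal.zero_ne_top
  · exact absurd h.symm (EReal.coe_ne_top _)

theorem fSgn_inj (a : ℝ) (ha : 0 < a) (s : Bool) : Function.Injective (fSgn a s) := by
  intro x y h
  cases s
  · simp only [fSgn, Bool.false_eq_true, if_false] at h
    exact eexp_mul_inj a ha (neg_injective h)
  · simp only [fSgn, if_true] at h
    exact eexp_mul_inj a ha h

theorem fWord_inj (a : ℝ) (ha : 0 < a) (l : List Bool) : Function.Injective (fWord a l) := by
  induction l with
  | nil => intro x y h; exact h
  | cons s l ih => intro x y h; exact ih (fSgn_inj a ha s h)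

theorem fSgn_eq_zero (a : ℝ) (s t : Bool) (hst : s ≠ t) (x y : EReal)
    (h : fSgn a s x = fSgn a t y) : fSgn a s x = 0 := by
  have key : ∀ u v : EReal, eexp u = -eexp v → eexp u = 0 := by
    intro u v h
    refine le_antisymm ?_ (eexp_nonneg' u)
    rw [h]
    simpa using EReal.neg_le_neg_iff.2 (eexp_nonneg' v)
  cases s <;> cases t <;> simp [fSgn] at hst h ⊢
  · rw [key _ _ h.symm] at h
    simpa using h
  · exact key _ _ h

theorem fWord_ofFn_succ (a : ℝ) (ε : ℕ → Bool) (k : ℕ) (z : EReal) :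
    fWord a (List.ofFn fun i : Fin (k + 1) => ε i) z
      = fWord a (List.ofFn fun i : Fin k => ε i) (fSgn a (ε k) z) := by
  rw [List.ofFn_succ']
  simp [fWord]

/-- For distinct sign sequences `ε ≠ ε'`, the intersection `I(ε) ∩ I(ε')`
contains at most one element. -/
theorem Iset_inter_subsingleton (a : ℝ) (ha : 0 < a) (ε ε' : ℕ → Bool) (hne : ε ≠ ε') :
    (Iset a ε ∩ Iset a ε').Subsingleton := by
  classical
  have hex : ∃ k, ε k ≠ ε' k := Function.ne_iff.1 hne
  obtain ⟨k, hk, hmin⟩ : ∃ k, ε k ≠ ε' k ∧ ∀ i < k, ε i = ε' i :=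
    ⟨Nat.find hex, Nat.find_spec hex, fun i hi => not_not.1 (Nat.find_min hex hi)⟩
  have hw : (List.ofFn fun i : Fin k => ε' i) = (List.ofFn fun i : Fin k => ε i) := by
    congr 1
    funext i
    exact (hmin i i.2).symm
  have main : ∀ x ∈ Iset a ε ∩ Iset a ε', x = fWord a (List.ofFn fun i : Fin k => ε i) 0 := by
    rintro x ⟨h1, h2⟩
    obtain ⟨z, hz⟩ := Set.mem_iInter.1 h1 (k + 1)
    obtain ⟨z', hz'⟩ := Set.mem_iInter.1 h2 (k + 1)
    rw [fWord_ofFn_succ] at hz hz'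
    rw [hw] at hz'
    have h := fWord_inj a ha _ (hz.trans hz'.symm)
    rw [← hz, fSgn_eq_zero a _ _ hk _ _ h]
  intro x hx y hy
  rw [main x hx, main y hy]
end
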